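/- Let (Ω, F, P) be a probability space, X : Ω → (Fin p → ℝ) measurable, σ(X) the σ-algebra generated by X, β ∈ (Fin p → ℝ), and B : Ω → ℝ integrable with E[B | σ(X)] = 0 P-almost everywhere. Let Q, Q' : (Fin p → ℝ) → (Fin p → ℝ) be Borel measurable, and assume all of (⟨Q(X) − X, β⟩)², (⟨Q'(X) − X, β⟩)², B², ⟨Q(X) − X, β⟩·B, and ⟨Q'(X) − X, β⟩·B are integrable. Then E[(⟨Q(X) − X, β⟩ + B)²] ≤ E[(⟨Q'(X) − X, β⟩ + B)²] if and only if E[(⟨Q(X) − X, β⟩)²] ≤ E[(⟨Q'(X) − X, β⟩)²]. -/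

import Mathlib

open MeasureTheory Finset

/-- If `f ∘ X` is multiplied by an integrable variable `B` with zero conditional mean given
`X`, the product integrates to zero. -/
theorem integral_comp_mul_eq_zero_of_condExp_eq_zero
    {Ω E : Type*} [MeasurableSpace Ω] [MeasurableSpace E] {P : Measure Ω} [IsFiniteMeasure P]
    {X : Ω → E} (hX : Measurable X) {B : Ω → ℝ} (hB : Integrable B P)
    (hcond : P[B | MeasurableSpace.comap X inferInstance] =ᵐ[P] 0)
    {f : E → ℝ} (hf : Measurable f) (hfB : Integrable (fun ω => f (X ω) * B ω) P) :
    ∫ ω, f (X ω) * B ω ∂P = 0 := by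
  have hfX : StronglyMeasurable[MeasurableSpace.comap X inferInstance] (fun ω => f (X ω)) :=
    (hf.comp (comap_measurable X)).stronglyMeasurable
  have hpull := condExp_mul_of_stronglyMeasurable_left hfX hfB hB
  rw [← integral_condExp hX.comap_le]
  refine integral_eq_zero_of_ae ?_
  filter_upwards [hpull, hcond] with ω h₁ h₂
  refine h₁.trans ?_
  simp [h₂]

/-- The mean square of `f ∘ X + B` splits when `B` has zero conditional mean given `X`. -/
theorem integral_comp_add_sq_of_condExp_eq_zero
    {Ω E : Type*} [MeasurableSpace Ω] [MeasurableSpace E] {P : Measure Ω} [IsFiniteMeasure P]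
    {X : Ω → E} (hX : Measurable X) {B : Ω → ℝ} (hB : Integrable B P)
    (hcond : P[B | MeasurableSpace.comap X inferInstance] =ᵐ[P] 0)
    {f : E → ℝ} (hf : Measurable f) (hf2 : Integrable (fun ω => f (X ω) ^ 2) P)
    (hB2 : Integrable (fun ω => B ω ^ 2) P) (hfB : Integrable (fun ω => f (X ω) * B ω) P) :
    ∫ ω, (f (X ω) + B ω) ^ 2 ∂P = ∫ ω, f (X ω) ^ 2 ∂P + ∫ ω, B ω ^ 2 ∂P := by
  have hexpand : ∀ ω, (f (X ω) + B ω) ^ 2 = (f (X ω) ^ 2 + B ω ^ 2) + 2 * (f (X ω) * B ω) :=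
    fun ω => by ring
  have hsum : Integrable (fun ω => f (X ω) ^ 2 + B ω ^ 2) P := hf2.add hB2
  simp_rw [hexpand]
  rw [integral_add hsum (hfB.const_mul 2), integral_add hf2 hB2, integral_const_mul,
    integral_comp_mul_eq_zero_of_condExp_eq_zero hX hB hcond hf hfB, mul_zero, add_zero]

/-- under the zero-conditional-mean assumption on the other sensors'
aggregate quantization error `B`, comparing two quantizers `Q, Q'` by the full
mean-squared prediction error is equivalent to comparing them by the mean-squared
projected quantization error alone. -/
theorem mse_comparison_iff_projected_comparison
    {Ω : Type*} [MeasurableSpace Ω] (P : Measure Ω) [IsProbabilityMeasure P]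
    (p : ℕ)
    (X : Ω → (Fin p → ℝ)) (hX : Measurable X)
    (β : Fin p → ℝ)
    (B : Ω → ℝ) (hBint : Integrable B P)
    (hcond : P[B | MeasurableSpace.comap X inferInstance] =ᵐ[P] 0)
    (Q Q' : (Fin p → ℝ) → (Fin p → ℝ))
    (hQ : Measurable Q) (hQ' : Measurable Q')
    (hQ2 : Integrable (fun ω => (∑ r : Fin p, (Q (X ω) r - X ω r) * β r) ^ 2) P)
    (hQ'2 : Integrable (fun ω => (∑ r : Fin p, (Q' (X ω) r - X ω r) * β r) ^ 2) P)
    (hB2 : Integrable (fun ω => B ω ^ 2) P)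
    (hQB : Integrable (fun ω => (∑ r : Fin p, (Q (X ω) r - X ω r) * β r) * B ω) P)
    (hQ'B : Integrable (fun ω => (∑ r : Fin p, (Q' (X ω) r - X ω r) * β r) * B ω) P) :
    ((∫ ω, ((∑ r : Fin p, (Q (X ω) r - X ω r) * β r) + B ω) ^ 2 ∂P)
        ≤ ∫ ω, ((∑ r : Fin p, (Q' (X ω) r - X ω r) * β r) + B ω) ^ 2 ∂P)
      ↔ ((∫ ω, (∑ r : Fin p, (Q (X ω) r - X ω r) * β r) ^ 2 ∂P)
        ≤ ∫ ω, (∑ r : Fin p, (Q' (X ω) r - X ω r) * β r) ^ 2 ∂P) := by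
  have hmeas : ∀ q : (Fin p → ℝ) → (Fin p → ℝ), Measurable q →
      Measurable fun x => ∑ r : Fin p, (q x r - x r) * β r := fun q hq => by fun_prop
  rw [integral_comp_add_sq_of_condExp_eq_zero hX hBint hcond (hmeas Q hQ) hQ2 hB2 hQB,
    integral_comp_add_sq_of_condExp_eq_zero hX hBint hcond (hmeas Q' hQ') hQ'2 hB2 hQ'B,
    add_le_add_iff_right]
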